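/- arXiv:1812.02680 — 3 statements merged into one kernel-verified Lean document; each statement's English description precedes it below -/
import Mathlib

section
/- Suppose the matrices A(u) are diagonal with positive diagonal entries a_1(u),…,a_n(u) for μ-a.e. u in the support of Φ, and u ↦ |Φ(u)|(a_1(u)⋯a_n(u))^{-1/2} is μ-integrable. Let T be a continuous linear operator on L²((0,∞)ⁿ; ℂ) such that for every f ∈ L², (Tf)(x) = ∫_Ω Φ(u) f(A(u)x) dμ(u) for a.e. x ∈ (0,∞)ⁿ. Then there exists a linear isometric isomorphism M from L²((0,∞)ⁿ; ℂ) onto L²(ℝⁿ; ℂ) such that for every f, M(Tf)(s) = φ(s)·(Mf)(s) for a.e. s ∈ ℝⁿ, where φ(s) = ∫_Ω Φ(u) ∏_{j=1}^n a_j(u)^{-1/2 - i s_j} dμ(u); i.e., the Hausdorff operator on L²((0,∞)ⁿ) is unitarily equivalent to multiplication by its symbol φ. -/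
open MeasureTheory Complex Filter Matrix
open scoped ENNReal ComplexConjugate

theorem ae_comp_of_map_withDensity {α β : Type*} [MeasurableSpace α]
    [MeasurableSpace β] {ν : Measure α} {ρ : Measure β} {θ : α → β} {w : α → ℂ}
    (hθ : Measurable θ) (hw : Measurable w) (hw0 : ∀ t, w t ≠ 0)
    (hρ : ρ = (ν.withDensity fun t => ‖w t‖ₑ ^ 2).map θ) {p : β → Prop} (h : ∀ᵐ x ∂ρ, p x) :
    ∀ᵐ t ∂ν, p (θ t) := by
  rw [hρ] at h
  have h1 := ae_of_ae_map hθ.aemeasurable h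
  rw [ae_withDensity_iff (by fun_prop)] at h1
  filter_upwards [h1] with t ht
  exact ht (by simp [hw0 t])

theorem eLpNorm_two_weighted_comp {α β : Type*} [MeasurableSpace α]
    [MeasurableSpace β] {ν : Measure α} {ρ : Measure β} {θ : α → β} {w : α → ℂ}
    (hθ : Measurable θ) (hw : Measurable w)
    (hρ : ρ = (ν.withDensity fun t => ‖w t‖ₑ ^ 2).map θ) {f : β → ℂ} (hf : Measurable f) :
    eLpNorm (fun t => w t * f (θ t)) 2 ν = eLpNorm f 2 ρ := by
  rw [eLpNorm_eq_lintegral_rpow_enorm_toReal (by simp) (by simp),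
    eLpNorm_eq_lintegral_rpow_enorm_toReal (by simp) (by simp), hρ,
    lintegral_map (by fun_prop) hθ, lintegral_withDensity_eq_lintegral_mul _ (by fun_prop) (by fun_prop)]
  congr 1
  refine lintegral_congr fun t => ?_
  simp [enorm_mul, mul_pow]

/-- The weighted composition operator `f ↦ w · (f ∘ θ)` as a unitary map of `L²` spaces. -/
theorem exists_weighted_comp_linearIsometryEquiv {α β : Type*} [MeasurableSpace α]
    [MeasurableSpace β] {ν : Measure α} {ρ : Measure β} {θ : α → β} {l : β → α} {w : α → ℂ}
    (hθ : Measurable θ) (hl : Measurable l) (hlθ : ∀ t, l (θ t) = t)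
    (hw : Measurable w) (hw0 : ∀ t, w t ≠ 0)
    (hρ : ρ = (ν.withDensity fun t => ‖w t‖ₑ ^ 2).map θ) :
    ∃ E : Lp ℂ 2 ρ ≃ₗᵢ[ℂ] Lp ℂ 2 ν, ∀ f : Lp ℂ 2 ρ, E f =ᵐ[ν] fun t => w t * f (θ t) := by
  have hmem (f : Lp ℂ 2 ρ) : MemLp (fun t => w t * f (θ t)) 2 ν := by
    refine ⟨(hw.mul ((Lp.stronglyMeasurable f).measurable.comp hθ)).aestronglyMeasurable, ?_⟩
    rw [eLpNorm_two_weighted_comp hθ hw hρ (Lp.stronglyMeasurable f).measurable]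
    exact Lp.eLpNorm_lt_top f
  let L : Lp ℂ 2 ρ →ₗᵢ[ℂ] Lp ℂ 2 ν :=
    { toFun := fun f => (hmem f).toLp _
      map_add' := fun f g => by
        rw [← MemLp.toLp_add]
        refine MemLp.toLp_congr _ _ ?_
        filter_upwards [ae_comp_of_map_withDensity hθ hw hw0 hρ (Lp.coeFn_add f g)] with t ht
        simp only [ht, Pi.add_apply, mul_add]
      map_smul' := fun c f => by
        rw [RingHom.id_apply, ← MemLp.toLp_const_smul]
        refine MemLp.toLp_congr _ _ ?_
        filter_upwards [ae_comp_of_map_withDensity hθ hw hw0 hρ (Lp.coeFn_smul c f)] with t ht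
        simp only [ht, Pi.smul_apply, smul_eq_mul]
        ring
      norm_map' := fun f => by
        change ‖(hmem f).toLp _‖ = _
        rw [Lp.norm_toLp, Lp.norm_def,
          eLpNorm_two_weighted_comp hθ hw hρ (Lp.stronglyMeasurable f).measurable] }
  have hL (f) : L f =ᵐ[ν] fun t => w t * f (θ t) := (hmem f).coeFn_toLp
  have hsurj : Function.Surjective L := by
    intro g
    have hgm := (Lp.stronglyMeasurable g).measurable
    have hf : Measurable fun x => (w (l x))⁻¹ * g (l x) := by fun_prop
    have hcomp : (fun t => w t * ((w (l (θ t)))⁻¹ * g (l (θ t)))) = g := by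
      ext t
      rw [hlθ, mul_inv_cancel_left₀ (hw0 t)]
    have hfL : MemLp (fun x => (w (l x))⁻¹ * g (l x)) 2 ρ := by
      refine ⟨hf.aestronglyMeasurable, ?_⟩
      rw [← eLpNorm_two_weighted_comp hθ hw hρ hf, hcomp]
      exact Lp.eLpNorm_lt_top g
    refine ⟨hfL.toLp _, ?_⟩
    refine Lp.ext ?_
    filter_upwards [hL (hfL.toLp _),
      ae_comp_of_map_withDensity hθ hw hw0 hρ hfL.coeFn_toLp] with t h1 h2
    rw [h1, h2]
    exact congrFun hcomp t
  exact ⟨LinearIsometryEquiv.ofSurjective L hsurj, hL⟩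

theorem exists_add_ae_ne_zero {α : Type*} [MeasurableSpace α] {ν : Measure α} [SigmaFinite ν]
    (f : Lp ℂ 2 ν) : ∃ f₁ f₂ : Lp ℂ 2 ν, f = f₁ + f₂ ∧ (∀ᵐ x ∂ν, f₁ x ≠ 0) ∧
      ∀ᵐ x ∂ν, f₂ x ≠ 0 := by
  obtain ⟨g, hg0, hgm, hg⟩ := exists_pos_lintegral_lt_of_sigmaFinite ν one_ne_zero
  classical
  have hfm := (Lp.stronglyMeasurable f).measurable
  let r : α → ℂ := fun x => ((Real.sqrt (g x) : ℝ) : ℂ)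
  have hrm : Measurable r := by fun_prop
  have hr0 (x) : r x ≠ 0 := by
    simpa [r, Real.sqrt_eq_zero'] using (hg0 x).ne'
  have hr : MemLp r 2 ν := by
    refine ⟨hrm.aestronglyMeasurable, ?_⟩
    rw [eLpNorm_lt_top_iff_lintegral_rpow_enorm_lt_top (by simp) (by simp)]
    refine lt_of_le_of_lt (lintegral_mono fun x => le_of_eq ?_) (hg.trans ENNReal.one_lt_top)
    have : ‖r x‖ₑ = ENNReal.ofReal (Real.sqrt (g x)) := by
      rw [← ofReal_norm, Complex.norm_real, Real.norm_of_nonneg (Real.sqrt_nonneg _)]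
    rw [this]
    simp [← ENNReal.ofReal_pow (Real.sqrt_nonneg _)]
  let w : α → ℂ := fun x => if f x = -r x then 2 * r x else r x
  have hwm : Measurable w := Measurable.ite (measurableSet_eq_fun hfm hrm.neg) (by fun_prop) hrm
  have hw : MemLp w 2 ν := by
    refine (hr.const_mul 2).mono hwm.aestronglyMeasurable (ae_of_all _ fun x => ?_)
    simp only [w]
    split_ifs
    · rfl
    · rw [norm_mul]; norm_num; linarith [norm_nonneg (r x)]
  refine ⟨f + hw.toLp w, -hw.toLp w, by simp, ?_, ?_⟩
  · filter_upwards [Lp.coeFn_add f (hw.toLp w), hw.coeFn_toLp] with x h1 h2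
    rw [h1, Pi.add_apply, h2]
    simp only [w]
    split_ifs with h
    · rw [h]; intro h3; exact hr0 x (by linear_combination h3)
    · intro h3; exact h (eq_neg_of_add_eq_zero_left h3)
  · filter_upwards [Lp.coeFn_neg (hw.toLp w), hw.coeFn_toLp] with x h1 h2
    rw [h1, Pi.neg_apply, h2, neg_ne_zero]
    simp only [w]
    split_ifs
    · exact mul_ne_zero two_ne_zero (hr0 x)
    · exact hr0 x

open FourierTransform in
theorem fourier_translate_ae_eq {V : Type*} [NormedAddCommGroup V] [InnerProductSpace ℝ V]
    [FiniteDimensional ℝ V] [MeasurableSpace V] [BorelSpace V] (v : V)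
    (f g : Lp ℂ 2 (volume : Measure V)) (hg : g =ᵐ[volume] fun t => f (t - v)) :
    Lp.fourierTransformₗᵢ V ℂ g =ᵐ[volume]
      fun s => (Real.fourierChar (-inner ℝ v s) : ℂ) * Lp.fourierTransformₗᵢ V ℂ f s := by
  obtain ⟨E, hE⟩ := exists_weighted_comp_linearIsometryEquiv (ν := (volume : Measure V))
    (ρ := (volume : Measure V)) (θ := fun t => t - v) (l := fun t => t + v) (w := fun _ => 1)
    (by fun_prop) (by fun_prop) (by simp) (by fun_prop) (by simp)
    (by simp [(measurePreserving_sub_right volume v).map_eq])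
  obtain ⟨D, hD⟩ := exists_weighted_comp_linearIsometryEquiv (ν := (volume : Measure V))
    (ρ := (volume : Measure V)) (θ := fun t => t) (l := fun t => t)
    (w := fun s => (Real.fourierChar (-inner ℝ v s) : ℂ))
    (by fun_prop) (by fun_prop) (by simp)
    (by
      have : Continuous fun s : V => (Real.fourierChar (-inner ℝ v s) : ℂ) := by fun_prop
      exact this.measurable)
    (by simp) (by
      have (s : V) : ‖(Real.fourierChar (-inner ℝ v s) : ℂ)‖ₑ = 1 := by
        rw [← ofReal_norm, Circle.norm_coe]; simp
      simp [this, Measure.map_id'])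
  have hgE : g = E f := by
    refine Lp.ext ?_
    filter_upwards [hg, hE f] with t h1 h2
    rw [h1, h2, one_mul]
  suffices h : Lp.fourierTransformₗᵢ V ℂ (E f) = D (Lp.fourierTransformₗᵢ V ℂ f) by
    rw [hgE, h]; exact hD _
  refine (SchwartzMap.denseRange_toLpCLM (E := V) (F := ℂ) (μ := volume) (p := 2)
    ENNReal.ofNat_ne_top).induction_on
    (p := fun f => Lp.fourierTransformₗᵢ V ℂ (E f) = D (Lp.fourierTransformₗᵢ V ℂ f)) f
    (isClosed_eq ((LinearIsometryEquiv.continuous _).comp E.continuous)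
      (D.continuous.comp (LinearIsometryEquiv.continuous _))) ?_
  intro ψ
  rw [SchwartzMap.toLpCLM_apply]
  have h1 : E (ψ.toLp 2) = (ψ.compSubConstCLM ℂ v).toLp 2 := by
    refine Lp.ext ?_
    filter_upwards [hE (ψ.toLp 2), (ψ.compSubConstCLM ℂ v).coeFn_toLp 2 volume,
      (measurePreserving_sub_right volume v).quasiMeasurePreserving.ae (ψ.coeFn_toLp 2 volume)]
      with t h1 h2 h3
    rw [h1, h2, h3, one_mul, SchwartzMap.compSubConstCLM_apply]
  have hF (χ : SchwartzMap V ℂ) : Lp.fourierTransformₗᵢ V ℂ (χ.toLp 2) = (𝓕 χ).toLp 2 :=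
    χ.toLp_fourier_eq
  rw [h1, hF, hF]
  refine Lp.ext ?_
  filter_upwards [hD ((𝓕 ψ).toLp 2), (𝓕 ψ).coeFn_toLp 2 volume,
    (𝓕 (ψ.compSubConstCLM ℂ v)).coeFn_toLp 2 volume] with s h1 h2 h3
  rw [h1, h2, h3, SchwartzMap.fourier_coe, SchwartzMap.fourier_coe]
  have := congrFun (VectorFourier.fourierIntegral_comp_add_right Real.fourierChar
    (volume : Measure V) (innerₗ V) ψ (-v)) s
  simpa [Function.comp_def, ← sub_eq_add_neg, Circle.smul_def] using! this

theorem integrable_mul_prod_of_bound {Ω V : Type*} [MeasurableSpace Ω] [MeasurableSpace V]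
    {μ : Measure Ω} [SigmaFinite μ] {ν : Measure V} [SigmaFinite ν] {Ψ : Ω → ℂ}
    (hΨ : Integrable Ψ μ) {K : Ω → V → ℂ} (hK : StronglyMeasurable (Function.uncurry K))
    {B : Ω → V → ℝ} (hB : ∀ u, Integrable (B u) ν) (hKB : ∀ u t, ‖K u t‖ ≤ B u t) {C : ℝ}
    (hC : ∀ u, ∫ t, B u t ∂ν = C) :
    Integrable (Function.uncurry fun u t => Ψ u * K u t) (μ.prod ν) := by
  have hm : AEStronglyMeasurable (Function.uncurry fun u t => Ψ u * K u t) (μ.prod ν) :=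
    (hΨ.1.comp_quasiMeasurePreserving Measure.quasiMeasurePreserving_fst).mul
      hK.aestronglyMeasurable
  have hKi (u) : Integrable (K u) ν :=
    (hB u).mono' (hK.comp_measurable measurable_prodMk_left).aestronglyMeasurable
      (ae_of_all _ (hKB u))
  rw [integrable_prod_iff hm]
  refine ⟨ae_of_all _ fun u => (hKi u).const_mul (Ψ u), ?_⟩
  refine (hΨ.norm.mul_const C).mono' hm.norm.integral_prod_right' (ae_of_all _ fun u => ?_)
  simp only [Function.uncurry_apply_pair, norm_mul, integral_const_mul, norm_norm]
  rw [Real.norm_of_nonneg (integral_nonneg fun _ => norm_nonneg _)]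
  gcongr
  rw [← hC u]
  exact integral_mono (hKi u).norm (hB u) (hKB u)

theorem fourier_integral_translates {Ω V : Type*} [MeasurableSpace Ω] {μ : Measure Ω}
    [SigmaFinite μ] [NormedAddCommGroup V] [InnerProductSpace ℝ V]
    [FiniteDimensional ℝ V] [MeasurableSpace V] [BorelSpace V] {Ψ : Ω → ℂ}
    (hΨ : Integrable Ψ μ) {v : Ω → V} (hv : Measurable v) {g : V → ℂ} (hgm : Measurable g)
    {G S : Lp ℂ 2 (volume : Measure V)} (hG : G =ᵐ[volume] g)
    (hS : S =ᵐ[volume] fun t => ∫ u, Ψ u * g (t - v u) ∂μ) :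
    Lp.fourierTransformₗᵢ V ℂ S =ᵐ[volume]
      fun s => (∫ u, Ψ u * (Real.fourierChar (-inner ℝ (v u) s) : ℂ) ∂μ) *
        Lp.fourierTransformₗᵢ V ℂ G s := by
  set F := Lp.fourierTransformₗᵢ V ℂ
  have hg : MemLp g 2 volume := (memLp_congr_ae hG).1 (Lp.memLp G)
  have hgu (u) : MemLp (fun t => g (t - v u)) 2 volume :=
    hg.comp_measurePreserving (measurePreserving_sub_right volume (v u))
  let Gu : Ω → Lp ℂ 2 (volume : Measure V) := fun u => (hgu u).toLp _
  have hFG (u) := fourier_translate_ae_eq (v u) G (Gu u) (by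
    filter_upwards [(hgu u).coeFn_toLp,
      (measurePreserving_sub_right volume (v u)).quasiMeasurePreserving.ae hG] with t h1 h2
    exact h1.trans h2.symm)
  have hχm : StronglyMeasurable (fun p : Ω × V =>
      (Real.fourierChar (-inner ℝ (v p.1) p.2) : ℂ)) := by
    have h : Continuous fun q : V × V => (Real.fourierChar (-inner ℝ q.1 q.2) : ℂ) := by fun_prop
    exact (h.measurable.comp ((hv.comp measurable_fst).prodMk measurable_snd)).stronglyMeasurable
  set φ : V → ℂ := fun s => ∫ u, Ψ u * (Real.fourierChar (-inner ℝ (v u) s) : ℂ) ∂μ with hφ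
  have hφm : AEStronglyMeasurable φ volume := by
    have : AEStronglyMeasurable (fun p : V × Ω =>
        Ψ p.2 * (Real.fourierChar (-inner ℝ (v p.2) p.1) : ℂ)) (volume.prod μ) :=
      (hΨ.1.comp_quasiMeasurePreserving Measure.quasiMeasurePreserving_snd).mul
        (hχm.comp_measurable measurable_swap).aestronglyMeasurable
    exact this.integral_prod_right'
  have hφb (s) : ‖φ s‖ ≤ ∫ u, ‖Ψ u‖ ∂μ := by
    refine (norm_integral_le_integral_norm _).trans_eq (integral_congr_ae (ae_of_all _ fun u => ?_))
    change ‖_ * _‖ = _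
    rw [norm_mul, Circle.norm_coe, mul_one]
  have hP : MemLp (fun s => φ s * F G s) 2 volume := by
    refine MemLp.of_le_mul (c := ∫ u, ‖Ψ u‖ ∂μ) (Lp.memLp (F G))
      (hφm.mul (Lp.memLp (F G)).1) (ae_of_all _ fun s => ?_)
    rw [norm_mul]
    gcongr
    exact hφb s
  suffices h : F S = hP.toLp _ by rw [h]; exact hP.coeFn_toLp
  refine ext_inner_left ℂ fun k => ?_
  obtain ⟨h, rfl⟩ := F.surjective k
  have hhm := (Lp.stronglyMeasurable h).measurable
  have hFGm := (Lp.stronglyMeasurable (F G)).measurable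
  have hFhm := (Lp.stronglyMeasurable (F h)).measurable
  calc inner ℂ (F h) (F S) = ∫ t, ∫ u, Ψ u * (g (t - v u) * conj (h t)) ∂μ := by
        rw [LinearIsometryEquiv.inner_map_map, L2.inner_def]
        refine integral_congr_ae ?_
        filter_upwards [hS] with t ht
        rw [RCLike.inner_apply, ht, ← integral_mul_const]
        simp only [mul_assoc]
    _ = ∫ u, (∫ t, Ψ u * (g (t - v u) * conj (h t))) ∂μ := by
        symm
        refine integral_integral_swap (integrable_mul_prod_of_bound hΨ
          (B := fun u t => ‖g (t - v u)‖ ^ 2 + ‖h t‖ ^ 2)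
          (C := (∫ t, ‖g t‖ ^ 2) + ∫ t, ‖h t‖ ^ 2) ?_ ?_ ?_ ?_)
        · refine Measurable.stronglyMeasurable ?_
          simp only [Function.uncurry_def]
          fun_prop
        · exact fun u => (hgu u).integrable_norm_pow two_ne_zero |>.add
            ((Lp.memLp h).integrable_norm_pow two_ne_zero)
        · intro u t
          rw [norm_mul, RCLike.norm_conj]
          nlinarith [sq_nonneg (‖g (t - v u)‖ - ‖h t‖), sq_nonneg (‖g (t - v u)‖), sq_nonneg ‖h t‖]
        · intro u
          rw [integral_add ((hgu u).integrable_norm_pow two_ne_zero)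
            ((Lp.memLp h).integrable_norm_pow two_ne_zero)]
          exact congrArg (· + _) (integral_sub_right_eq_self (μ := (volume : Measure V))
            (fun t => ‖g t‖ ^ (2 : ℕ)) (v u))
    _ = ∫ u, (∫ s, Ψ u * ((Real.fourierChar (-inner ℝ (v u) s) : ℂ) *
          (F G s * conj (F h s)))) ∂μ := by
        refine integral_congr_ae (ae_of_all _ fun u => ?_)
        simp only [integral_const_mul]
        congr 1
        have h1 : ∫ t, g (t - v u) * conj (h t) = inner ℂ h (Gu u) := by
          rw [L2.inner_def]
          refine integral_congr_ae ?_
          filter_upwards [(hgu u).coeFn_toLp] with t ht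
          rw [RCLike.inner_apply, ht]
        rw [h1, ← F.inner_map_map, L2.inner_def]
        refine integral_congr_ae ?_
        filter_upwards [hFG u] with s hs
        rw [RCLike.inner_apply, hs, mul_assoc]
    _ = ∫ s, ∫ u, Ψ u * ((Real.fourierChar (-inner ℝ (v u) s) : ℂ) *
          (F G s * conj (F h s))) ∂μ := by
        refine integral_integral_swap (integrable_mul_prod_of_bound hΨ
          (B := fun _ s => ‖F G s * conj (F h s)‖)
          (C := ∫ s, ‖F G s * conj (F h s)‖) ?_ ?_ ?_ ?_)
        · refine hχm.mul (Measurable.stronglyMeasurable ?_)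
          fun_prop
        · exact fun _ => (L2.integrable_inner (𝕜 := ℂ) (F h) (F G)).norm
        · intro u s
          rw [norm_mul, Circle.norm_coe, one_mul]
        · exact fun _ => rfl
    _ = inner ℂ (F h) (hP.toLp _) := by
        rw [L2.inner_def]
        refine integral_congr_ae ?_
        filter_upwards [hP.coeFn_toLp] with s hs
        rw [RCLike.inner_apply, hs, hφ, mul_assoc, ← integral_mul_const]
        simp only [mul_assoc]

theorem integral_mul_eq_zero_of_not_aestronglyMeasurable {Ω : Type*} [MeasurableSpace Ω]
    {μ : Measure Ω} {Ψ c : Ω → ℂ} (hΨ : ¬AEStronglyMeasurable Ψ μ) (hc : Measurable c)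
    (hc0 : ∀ᵐ u ∂μ, c u ≠ 0) : ∫ u, Ψ u * c u ∂μ = 0 := by
  refine integral_non_aestronglyMeasurable fun h => hΨ ?_
  refine (h.mul hc.inv.aestronglyMeasurable).congr ?_
  filter_upwards [hc0] with u hu
  simp [hu]

theorem ae_integral_translates_eq_zero {Ω V : Type*} [MeasurableSpace Ω] {μ : Measure Ω}
    [SigmaFinite μ] [NormedAddCommGroup V] [InnerProductSpace ℝ V]
    [FiniteDimensional ℝ V] [MeasurableSpace V] [BorelSpace V] {Ψ : Ω → ℂ}
    (hΨ : ¬AEStronglyMeasurable Ψ μ) {v : Ω → V} (hv : Measurable v) {g : V → ℂ}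
    (hgm : Measurable g) (hg : ∀ᵐ t ∂(volume : Measure V), g t ≠ 0) :
    ∀ᵐ t ∂(volume : Measure V), ∫ u, Ψ u * g (t - v u) ∂μ = 0 := by
  have h : ∀ᵐ t ∂(volume : Measure V), ∀ᵐ u ∂μ, g (t - v u) ≠ 0 := by
    rw [Measure.ae_ae_comm]
    · exact ae_of_all _ fun u =>
        (measurePreserving_sub_right volume (v u)).quasiMeasurePreserving.ae hg
    · have : Measurable fun p : V × Ω => g (p.1 - v p.2) := by fun_prop
      exact this (measurableSet_singleton 0).compl
  filter_upwards [h] with t ht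
  exact integral_mul_eq_zero_of_not_aestronglyMeasurable hΨ (by fun_prop) ht

/-- Coordinatewise exponential parametrization of the positive orthant. -/
noncomputable def orthantExp (n : ℕ) (t : Fin n → ℝ) : Fin n → ℝ :=
  fun j => Real.exp (-(2 * Real.pi * t j))

/-- The square root of the Jacobian determinant of `orthantExp`. -/
noncomputable def orthantWeight (n : ℕ) (t : Fin n → ℝ) : ℝ :=
  ∏ j, Real.sqrt (2 * Real.pi * orthantExp n t j)

theorem orthantExp_pos {n : ℕ} (t : Fin n → ℝ) (j : Fin n) : 0 < orthantExp n t j :=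
  Real.exp_pos _

theorem orthantWeight_pos {n : ℕ} (t : Fin n → ℝ) : 0 < orthantWeight n t :=
  Finset.prod_pos fun j _ =>
    Real.sqrt_pos.2 (mul_pos (by positivity) (orthantExp_pos t j))

theorem measurable_orthantExp (n : ℕ) : Measurable (orthantExp n) := by
  unfold orthantExp
  fun_prop

theorem measurable_orthantWeight (n : ℕ) : Measurable (orthantWeight n) := by
  have := measurable_orthantExp n
  unfold orthantWeight
  fun_prop

theorem log_orthantExp {n : ℕ} (t : Fin n → ℝ) (j : Fin n) :
    -(Real.log (orthantExp n t j) / (2 * Real.pi)) = t j := by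
  have := Real.pi_pos
  rw [orthantExp, Real.log_exp]
  field_simp

theorem orthantExp_log {n : ℕ} {x : Fin n → ℝ} (hx : ∀ j, 0 < x j) :
    orthantExp n (fun j => -(Real.log (x j) / (2 * Real.pi))) = x := by
  have := Real.pi_pos
  ext j
  rw [orthantExp]
  convert Real.exp_log (hx j) using 2
  field_simp

theorem orthantExp_injective (n : ℕ) : Function.Injective (orthantExp n) := fun s t h => by
  ext j
  rw [← log_orthantExp s, h, log_orthantExp]

theorem orthantExp_sub_log {n : ℕ} {b : Fin n → ℝ} (hb : ∀ j, 0 < b j) (t : Fin n → ℝ) :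
    orthantExp n (fun j => t j - Real.log (b j) / (2 * Real.pi)) =
      fun j => b j * orthantExp n t j := by
  have := Real.pi_pos
  ext j
  rw [orthantExp, orthantExp]
  nth_rewrite 2 [← Real.exp_log (hb j)]
  rw [← Real.exp_add]
  congr 1
  field_simp
  ring

theorem orthantWeight_sub_log {n : ℕ} {b : Fin n → ℝ} (hb : ∀ j, 0 < b j) (t : Fin n → ℝ) :
    orthantWeight n (fun j => t j - Real.log (b j) / (2 * Real.pi)) =
      Real.sqrt (∏ j, b j) * orthantWeight n t := by
  rw [orthantWeight, orthantExp_sub_log hb, orthantWeight,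
    Real.sqrt_prod _ fun j _ => (hb j).le, ← Finset.prod_mul_distrib]
  refine Finset.prod_congr rfl fun j _ => ?_
  rw [← Real.sqrt_mul (hb j).le]
  congr 1
  ring

theorem orthantWeight_sq {n : ℕ} (t : Fin n → ℝ) :
    orthantWeight n t ^ 2 = ∏ j, (2 * Real.pi * orthantExp n t j) := by
  rw [orthantWeight, ← Finset.prod_pow]
  exact Finset.prod_congr rfl fun j _ =>
    Real.sq_sqrt (mul_nonneg (by positivity) (orthantExp_pos t j).le)

theorem hasFDerivAt_orthantExp {n : ℕ} (t : Fin n → ℝ) :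
    HasFDerivAt (orthantExp n) (Matrix.toLin' (Matrix.diagonal fun j =>
      -(2 * Real.pi * orthantExp n t j))).toContinuousLinearMap t := by
  rw [hasFDerivAt_pi']
  intro j
  have h : HasFDerivAt (fun t : Fin n → ℝ => -(2 * Real.pi * t j))
      (-((2 * Real.pi) • ContinuousLinearMap.proj (R := ℝ) (φ := fun _ : Fin n => ℝ) j)) t :=
    ((hasFDerivAt_apply j t).const_mul (2 * Real.pi)).neg
  convert! h.exp using 1
  ext x
  simp [Matrix.mulVec_diagonal, orthantExp]
  ring

theorem restrict_orthant_eq_map (n : ℕ) :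
    (volume : Measure (Fin n → ℝ)).restrict {x | ∀ i, 0 < x i} =
      ((volume : Measure (EuclideanSpace ℝ (Fin n))).withDensity
        fun t => ‖(orthantWeight n t.ofLp : ℂ)‖ₑ ^ 2).map fun t => orthantExp n t.ofLp := by
  have hE := measurable_orthantExp n
  have hW := measurable_orthantWeight n
  have hθ : Measurable fun t : EuclideanSpace ℝ (Fin n) => orthantExp n t.ofLp := by fun_prop
  ext s hs
  have hpre : MeasurableSet ((fun t : EuclideanSpace ℝ (Fin n) => orthantExp n t.ofLp) ⁻¹' s) :=
    hθ hs
  rw [Measure.map_apply hθ hs, withDensity_apply _ hpre,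
    Measure.restrict_apply hs,
    ← (PiLp.volume_preserving_toLp (Fin n)).setLIntegral_comp_preimage hpre (by fun_prop)]
  have himg : s ∩ {x | ∀ i, 0 < x i} = orthantExp n '' (orthantExp n ⁻¹' s) := by
    rw [Set.image_preimage_eq_inter_range]
    congr 1
    ext x
    exact ⟨fun hx => ⟨_, orthantExp_log hx⟩, by rintro ⟨t, rfl⟩; exact orthantExp_pos t⟩
  rw [himg, ← lintegral_abs_det_fderiv_eq_addHaar_image volume (hE hs)
    (fun t _ => (hasFDerivAt_orthantExp t).hasFDerivWithinAt) (orthantExp_injective n).injOn]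
  refine setLIntegral_congr_fun (hE hs) fun t _ => ?_
  simp only
  rw [ContinuousLinearMap.det, LinearMap.coe_toContinuousLinearMap, LinearMap.det_toLin',
    Matrix.det_diagonal, Finset.abs_prod, ← ofReal_norm, Complex.norm_real,
    ← ENNReal.ofReal_pow (norm_nonneg _), Real.norm_eq_abs, sq_abs, orthantWeight_sq]
  congr 1
  refine Finset.prod_congr rfl fun j _ => ?_
  rw [abs_neg, abs_of_nonneg (mul_nonneg (by positivity) (orthantExp_pos t j).le)]

theorem prod_cpow_eq_rpow_mul_fourierChar {n : ℕ} {b : Fin n → ℝ} (hb : ∀ j, 0 < b j)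
    (s : Fin n → ℝ) :
    ∏ j, (b j : ℂ) ^ (-(1 / 2 : ℂ) - Complex.I * (s j : ℂ)) =
      (((∏ j, b j) ^ (-((1 : ℝ) / 2)) : ℝ) : ℂ) * (Real.fourierChar
        (-inner ℝ (WithLp.toLp 2 fun j => Real.log (b j) / (2 * Real.pi) :
          EuclideanSpace ℝ (Fin n)) (WithLp.toLp 2 s)) : ℂ) := by
  have h1 (j) : (b j : ℂ) ^ (-(1 / 2 : ℂ) - Complex.I * (s j : ℂ)) =
      Complex.exp ((Real.log (b j) : ℂ) * (-(1 / 2 : ℂ) - Complex.I * (s j : ℂ))) := by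
    rw [Complex.cpow_def_of_ne_zero (by exact_mod_cast (hb j).ne'), Complex.ofReal_log (hb j).le]
  have hpi : (Real.pi : ℂ) ≠ 0 := by exact_mod_cast Real.pi_ne_zero
  rw [Finset.prod_congr rfl fun j _ => h1 j, ← Complex.exp_sum,
    Real.rpow_def_of_pos (Finset.prod_pos fun j _ => hb j),
    Real.log_prod fun j _ => (hb j).ne', Real.fourierChar_apply, Complex.ofReal_exp,
    ← Complex.exp_add]
  congr 1
  simp only [PiLp.inner_apply, RCLike.inner_apply, conj_trivial]
  push_cast
  rw [Finset.sum_mul, mul_neg, neg_mul, Finset.mul_sum, Finset.sum_mul, ← sub_eq_add_neg,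
    ← Finset.sum_sub_distrib]
  refine Finset.sum_congr rfl fun j _ => ?_
  field_simp

/-- A Hausdorff operator on `L²((0,∞)ⁿ)` with diagonal matrices having positive diagonal
entries is unitarily equivalent (via the Mellin transform) to multiplication by its symbol
`φ(s) = ∫ Φ(u) ∏_j a_j(u)^{-1/2 - i s_j} dμ(u)` on `L²(ℝⁿ)`. -/
theorem hausdorff_structure_orthant {Ω : Type*} [MeasurableSpace Ω] (μ : Measure Ω)
    [SigmaFinite μ] (n : ℕ)
    (Φ : Ω → ℂ) (A : Ω → Matrix (Fin n) (Fin n) ℝ)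
    (a : Fin n → Ω → ℝ) (ha : ∀ j, Measurable (a j))
    (hapos : ∀ᵐ u ∂μ, Φ u ≠ 0 → ∀ j, 0 < a j u)
    (hdiag : ∀ᵐ u ∂μ, Φ u ≠ 0 → A u = Matrix.diagonal (fun j => a j u))
    (hint : Integrable (fun u => ‖Φ u‖ * (∏ j, a j u) ^ (-((1 : ℝ) / 2))) μ)
    (T : Lp ℂ 2 ((volume : Measure (Fin n → ℝ)).restrict {x | ∀ i, 0 < x i}) →L[ℂ]
        Lp ℂ 2 ((volume : Measure (Fin n → ℝ)).restrict {x | ∀ i, 0 < x i}))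
    (hT : ∀ f : Lp ℂ 2 ((volume : Measure (Fin n → ℝ)).restrict {x | ∀ i, 0 < x i}),
      ∀ᵐ x : Fin n → ℝ ∂(volume : Measure (Fin n → ℝ)).restrict {x | ∀ i, 0 < x i},
        T f x = ∫ u, Φ u * f ((A u).mulVec x) ∂μ)
    (φ : (Fin n → ℝ) → ℂ)
    (hφ : ∀ s : Fin n → ℝ,
      φ s = ∫ u, Φ u * ∏ j, (a j u : ℂ) ^ (-(1 / 2 : ℂ) - Complex.I * (s j : ℂ)) ∂μ) :
    ∃ M : Lp ℂ 2 ((volume : Measure (Fin n → ℝ)).restrict {x | ∀ i, 0 < x i}) ≃ₗᵢ[ℂ]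
        Lp ℂ 2 (volume : Measure (Fin n → ℝ)),
      ∀ f : Lp ℂ 2 ((volume : Measure (Fin n → ℝ)).restrict {x | ∀ i, 0 < x i}),
        ∀ᵐ s : Fin n → ℝ ∂volume, M (T f) s = φ s * M f s := by
  have hexp := measurable_orthantExp n
  have hweight := measurable_orthantWeight n
  have hθ : Measurable fun t : EuclideanSpace ℝ (Fin n) => orthantExp n t.ofLp := by fun_prop
  have hw : Measurable fun t : EuclideanSpace ℝ (Fin n) => (orthantWeight n t.ofLp : ℂ) := by
    fun_prop
  have hw0 (t : EuclideanSpace ℝ (Fin n)) : (orthantWeight n t.ofLp : ℂ) ≠ 0 := by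
    exact_mod_cast (orthantWeight_pos t.ofLp).ne'
  obtain ⟨E, hE⟩ := exists_weighted_comp_linearIsometryEquiv hθ
    (l := fun x => WithLp.toLp 2 fun j => -(Real.log (x j) / (2 * Real.pi)))
    (by fun_prop) (fun t => by simp only [log_orthantExp]) hw hw0 (restrict_orthant_eq_map n)
  obtain ⟨E', hE'⟩ := exists_weighted_comp_linearIsometryEquiv
    (ν := (volume : Measure (Fin n → ℝ))) (ρ := (volume : Measure (EuclideanSpace ℝ (Fin n))))
    (θ := WithLp.toLp 2) (l := WithLp.ofLp) (w := fun _ => 1)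
    (by fun_prop) (by fun_prop) (by simp) (by fun_prop) (by simp)
    (by simp [(PiLp.volume_preserving_toLp (Fin n)).map_eq])
  set F := Lp.fourierTransformₗᵢ (EuclideanSpace ℝ (Fin n)) ℂ with hF
  let Ψ : Ω → ℂ := fun u => Φ u * (((∏ j, a j u) ^ (-((1 : ℝ) / 2)) : ℝ) : ℂ)
  let v : Ω → EuclideanSpace ℝ (Fin n) :=
    fun u => WithLp.toLp 2 fun j => Real.log (a j u) / (2 * Real.pi)
  have hv : Measurable v := by fun_prop
  have hφΨ (s) : φ s =
      ∫ u, Ψ u * (Real.fourierChar (-inner ℝ (v u) (WithLp.toLp 2 s)) : ℂ) ∂μ := by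
    rw [hφ]
    refine integral_congr_ae ?_
    filter_upwards [hapos] with u hu
    by_cases h0 : Φ u = 0
    · simp [Ψ, h0]
    · rw [prod_cpow_eq_rpow_mul_fourierChar (hu h0), ← mul_assoc]
  let g : Lp ℂ 2 ((volume : Measure (Fin n → ℝ)).restrict {x | ∀ i, 0 < x i}) →
      EuclideanSpace ℝ (Fin n) → ℂ :=
    fun f t => (orthantWeight n t.ofLp : ℂ) * f (orthantExp n t.ofLp)
  have hg (f) : Measurable (g f) :=
    hw.mul ((Lp.stronglyMeasurable f).measurable.comp hθ)
  have hET (f) : E (T f) =ᵐ[volume] fun t => ∫ u, Ψ u * g f (t - v u) ∂μ := by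
    filter_upwards [hE (T f), ae_comp_of_map_withDensity hθ hw hw0
      (restrict_orthant_eq_map n) (hT f)] with t h1 h2
    rw [h1, h2, ← integral_const_mul]
    refine integral_congr_ae ?_
    filter_upwards [hapos, hdiag] with u hu hd
    by_cases h0 : Φ u = 0
    · simp [Ψ, h0]
    · have hb := hu h0
      have hp : 0 < ∏ j, a j u := Finset.prod_pos fun j _ => hb j
      have hsub : (t - v u).ofLp = fun j => t.ofLp j - Real.log (a j u) / (2 * Real.pi) := rfl
      have hA : A u *ᵥ orthantExp n t.ofLp = fun j => a j u * orthantExp n t.ofLp j := by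
        ext j
        rw [hd h0, Matrix.mulVec_diagonal]
      have hone : (∏ j, a j u) ^ (-((1 : ℝ) / 2)) * Real.sqrt (∏ j, a j u) = 1 := by
        rw [Real.sqrt_eq_rpow, ← Real.rpow_add hp]
        simp
      have hone' : ((((∏ j, a j u) ^ (-((1 : ℝ) / 2)) : ℝ) : ℂ)) *
          (Real.sqrt (∏ j, a j u) : ℂ) = 1 := by
        exact_mod_cast hone
      simp only [Ψ, g]
      rw [hsub, orthantExp_sub_log hb, orthantWeight_sub_log hb, hA]
      push_cast
      linear_combination (-(Φ u * orthantWeight n t.ofLp *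
        f fun j => a j u * orthantExp n t.ofLp j)) * hone'
  refine ⟨(E.trans F).trans E', fun f => ?_⟩
  have hM (f) : ((E.trans F).trans E') f =ᵐ[volume] fun s => F (E f) (WithLp.toLp 2 s) := by
    filter_upwards [hE' (F (E f))] with s hs
    simpa using hs
  by_cases hΨ : AEStronglyMeasurable Ψ μ
  · have hΨi : Integrable Ψ μ := by
      rw [← integrable_norm_iff hΨ]
      refine hint.congr ?_
      filter_upwards [hapos] with u hu
      by_cases h0 : Φ u = 0
      · simp [Ψ, h0]
      · have hp : 0 < ∏ j, a j u := Finset.prod_pos fun j _ => hu h0 j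
        rw [norm_mul, Complex.norm_real, Real.norm_of_nonneg (Real.rpow_nonneg hp.le _)]
    have key := fourier_integral_translates hΨi hv (hg f) (hE f) (hET f)
    filter_upwards [hM (T f), hM f,
      (PiLp.volume_preserving_toLp (Fin n)).quasiMeasurePreserving.ae key] with s h1 h2 h3
    rw [h1, h2, h3, hφΨ]
  · have hφ0 (s) : φ s = 0 := by
      rw [hφΨ]
      refine integral_mul_eq_zero_of_not_aestronglyMeasurable hΨ ?_ (ae_of_all _ fun u => by simp)
      have h : Continuous fun q : EuclideanSpace ℝ (Fin n) =>
        (Real.fourierChar (-inner ℝ q (WithLp.toLp 2 s)) : ℂ) := by fun_prop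
      exact h.measurable.comp hv
    have hT0 (f : Lp ℂ 2 ((volume : Measure (Fin n → ℝ)).restrict {x | ∀ i, 0 < x i}))
        (hf : ∀ᵐ x ∂(volume : Measure (Fin n → ℝ)).restrict {x | ∀ i, 0 < x i}, f x ≠ 0) :
        T f = 0 := by
      refine E.injective ?_
      rw [map_zero]
      refine Lp.ext ?_
      have hgf : ∀ᵐ t ∂(volume : Measure (EuclideanSpace ℝ (Fin n))), g f t ≠ 0 := by
        filter_upwards [ae_comp_of_map_withDensity hθ hw hw0
          (restrict_orthant_eq_map n) hf] with t ht
        exact mul_ne_zero (hw0 t) ht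
      filter_upwards [hET f, ae_integral_translates_eq_zero hΨ hv (hg f) hgf,
        Lp.coeFn_zero ℂ 2 (volume : Measure (EuclideanSpace ℝ (Fin n)))] with t h1 h2 h3
      rw [h1, h2, h3, Pi.zero_apply]
    obtain ⟨f₁, f₂, hf, h1, h2⟩ := exists_add_ae_ne_zero f
    have hTf : T f = 0 := by rw [hf, map_add, hT0 f₁ h1, hT0 f₂ h2, add_zero]
    rw [hTf, map_zero]
    filter_upwards [Lp.coeFn_zero ℂ 2 (volume : Measure (Fin n → ℝ))] with s hs
    rw [hs, hφ0, zero_mul, Pi.zero_apply]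
end

section
/- Fix k > 0 and let T be a continuous linear operator on L²(ℝ; ℂ) such that for every f ∈ L², (Tf)(x) = ∫_0^1 k(1−u)^{k−1} f(ux) du for a.e. x ∈ ℝ (the (C,k) Cesàro mean, (C,k)f(x) = (k/x^k)∫_0^x (x−t)^{k−1} f(t) dt). Then the symbol of T is φ(s) = Γ(k+1)Γ(1/2 − is)/Γ(k + 1/2 − is), and the operator norm of T equals √π · Γ(k+1)/Γ(k + 1/2). -/
open MeasureTheory Complex Filter Matrix
open scoped ENNReal ComplexConjugate

/-- Cauchy–Schwarz for the constant function `1`, in `ℝ≥0∞`-valued form. -/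
theorem sq_lintegral_le_measure_univ_mul {α : Type*} [MeasurableSpace α] (μ : Measure α)
    {h : α → ℝ≥0∞} (hh : AEMeasurable h μ) :
    (∫⁻ a, h a ∂μ) ^ 2 ≤ μ Set.univ * ∫⁻ a, h a ^ 2 ∂μ := by
  have H := ENNReal.lintegral_mul_le_Lp_mul_Lq μ Real.HolderConjugate.two_two
    (aemeasurable_const (b := (1 : ℝ≥0∞))) hh
  simp only [Pi.mul_apply, one_mul, ENNReal.rpow_ofNat, one_pow, lintegral_one] at H
  calc (∫⁻ a, h a ∂μ) ^ 2
      ≤ (μ Set.univ ^ (1 / 2 : ℝ) * (∫⁻ a, h a ^ 2 ∂μ) ^ (1 / 2 : ℝ)) ^ 2 := by gcongr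
    _ = _ := by
        rw [mul_pow, ← ENNReal.rpow_two, ← ENNReal.rpow_two, ← ENNReal.rpow_mul,
          ← ENNReal.rpow_mul]
        norm_num

theorem ofReal_mul_lintegral_comp_mul_left {u : ℝ} (hu : 0 < u) {g : ℝ → ℝ≥0∞}
    (hg : Measurable g) : ENNReal.ofReal u * ∫⁻ x, g (u * x) = ∫⁻ x, g x := by
  have hm : Measurable fun x : ℝ => u * x := by fun_prop
  conv_rhs => rw [← Real.smul_map_volume_mul_left hu.ne', abs_of_pos hu]
  rw [lintegral_smul_measure, lintegral_map hg hm, smul_eq_mul]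

/-- Minkowski-type bound for averages of dilations: the dilation by `u` has norm `u ^ (-1/2)`
on `L²`. -/
theorem lintegral_sq_lintegral_dilation_le {S : Set ℝ} (hS : MeasurableSet S)
    (hpos : S ⊆ Set.Ioi 0) {w g : ℝ → ℝ≥0∞} (hw : Measurable w) (hg : Measurable g)
    (hfin : ∫⁻ u in S, w u * ENNReal.ofReal (u ^ (-(1 / 2) : ℝ)) ≠ ∞) :
    ∫⁻ x, (∫⁻ u in S, w u * g (u * x)) ^ 2 ≤
      (∫⁻ u in S, w u * ENNReal.ofReal (u ^ (-(1 / 2) : ℝ))) ^ 2 * ∫⁻ x, g x ^ 2 := by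
  set v : ℝ → ℝ≥0∞ := fun u => w u * ENNReal.ofReal (u ^ (-(1 / 2) : ℝ)) with hv
  have hvm : Measurable v := by fun_prop
  set μ : Measure ℝ := (volume.restrict S).withDensity v with hμ
  have hμu : μ Set.univ = ∫⁻ u in S, v u := by
    rw [hμ, withDensity_apply _ .univ, Measure.restrict_univ]
  have hμfin : IsFiniteMeasure μ := ⟨by rw [hμu]; exact hfin.lt_top⟩
  have hμS : ∀ᵐ u ∂μ, u ∈ S :=
    (withDensity_absolutelyContinuous _ _).ae_le (ae_restrict_mem hS)
  have key (x : ℝ) : ∫⁻ u in S, w u * g (u * x) =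
      ∫⁻ u, ENNReal.ofReal (u ^ (1 / 2 : ℝ)) * g (u * x) ∂μ := by
    rw [hμ, lintegral_withDensity_eq_lintegral_mul _ hvm (by fun_prop)]
    refine setLIntegral_congr_fun hS fun u hu => ?_
    have hu0 : 0 < u := hpos hu
    simp only [hv, Pi.mul_apply]
    rw [mul_assoc, ← mul_assoc (ENNReal.ofReal _), ← ENNReal.ofReal_mul (by positivity),
      ← Real.rpow_add hu0]
    norm_num
  calc ∫⁻ x, (∫⁻ u in S, w u * g (u * x)) ^ 2
      ≤ ∫⁻ x, μ Set.univ * ∫⁻ u, (ENNReal.ofReal (u ^ (1 / 2 : ℝ)) * g (u * x)) ^ 2 ∂μ := by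
        refine lintegral_mono fun x => ?_
        rw [key]
        exact sq_lintegral_le_measure_univ_mul μ (by fun_prop)
    _ = μ Set.univ * ∫⁻ u, (∫⁻ x, (ENNReal.ofReal (u ^ (1 / 2 : ℝ)) * g (u * x)) ^ 2) ∂μ := by
        rw [lintegral_const_mul' _ _ (measure_ne_top _ _), lintegral_lintegral_swap]
        exact Measurable.aemeasurable (by fun_prop)
    _ = μ Set.univ * ∫⁻ _, (∫⁻ x, g x ^ 2) ∂μ := by
        congr 1
        refine lintegral_congr_ae ?_
        filter_upwards [hμS] with u hu
        have hu0 : 0 < u := hpos hu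
        rw [← ofReal_mul_lintegral_comp_mul_left hu0 (hg.pow_const 2),
          ← lintegral_const_mul _ (by fun_prop)]
        refine lintegral_congr fun x => ?_
        rw [mul_pow, ← ENNReal.ofReal_pow (by positivity), ← Real.rpow_mul_natCast hu0.le]
        norm_num
    _ = _ := by
        rw [lintegral_const, hμu]
        ring

theorem integrableOn_cesaro_symbol {k : ℝ} (hk : 0 < k) {a : ℂ} (ha : 0 < a.re) :
    IntegrableOn (fun u : ℝ => ((k * (1 - u) ^ (k - 1) : ℝ) : ℂ) * (u : ℂ) ^ (a - 1))
        (Set.Icc 0 1) ∧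
      ∫ u in Set.Icc (0 : ℝ) 1, ((k * (1 - u) ^ (k - 1) : ℝ) : ℂ) * (u : ℂ) ^ (a - 1) =
        Complex.Gamma (k + 1) * Complex.Gamma a / Complex.Gamma (k + a) := by
  have hk' : 0 < (k : ℂ).re := by simpa
  have heq : Set.EqOn
      (fun u : ℝ => (k : ℂ) * ((u : ℂ) ^ (a - 1) * (1 - (u : ℂ)) ^ ((k : ℂ) - 1)))
      (fun u : ℝ => ((k * (1 - u) ^ (k - 1) : ℝ) : ℂ) * (u : ℂ) ^ (a - 1)) (Set.Ioc 0 1) := by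
    intro u hu
    have : ((1 - u : ℝ) : ℂ) ^ ((k - 1 : ℝ) : ℂ) = (((1 - u) ^ (k - 1) : ℝ) : ℂ) :=
      (ofReal_cpow (by linarith [hu.2]) _).symm
    push_cast at this ⊢
    rw [← this]
    ring
  constructor
  · rw [integrableOn_Icc_iff_integrableOn_Ioc]
    refine IntegrableOn.congr_fun ?_ heq measurableSet_Ioc
    exact ((intervalIntegrable_iff_integrableOn_Ioc_of_le zero_le_one).1
      (betaIntegral_convergent ha hk')).const_mul _
  · rw [integral_Icc_eq_integral_Ioc, ← setIntegral_congr_fun measurableSet_Ioc heq,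
      integral_const_mul, ← intervalIntegral.integral_of_le zero_le_one]
    change (k : ℂ) * betaIntegral a k = _
    have hG : Complex.Gamma (k + a) ≠ 0 := by
      apply Complex.Gamma_ne_zero_of_re_pos
      simp only [add_re]; positivity
    rw [eq_div_iff hG, Complex.Gamma_add_one _ (by exact_mod_cast hk.ne'), mul_assoc,
      mul_assoc (k : ℂ), mul_comm (Complex.Gamma k), Gamma_mul_Gamma_eq_betaIntegral ha hk',
      add_comm a, mul_comm (betaIntegral a k)]

theorem integral_cesaro_weight_mul_rpow {k : ℝ} (hk : 0 < k) {a : ℝ} (ha : 0 < a) :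
    IntegrableOn (fun u : ℝ => k * (1 - u) ^ (k - 1) * u ^ (a - 1)) (Set.Ioo 0 1) ∧
      ∫ u in Set.Ioo (0 : ℝ) 1, k * (1 - u) ^ (k - 1) * u ^ (a - 1) =
        Real.Gamma (k + 1) * Real.Gamma a / Real.Gamma (k + a) := by
  obtain ⟨hi, he⟩ := integrableOn_cesaro_symbol hk (a := a) (by simpa)
  have heq : Set.EqOn
      (fun u : ℝ => ((k * (1 - u) ^ (k - 1) : ℝ) : ℂ) * (u : ℂ) ^ ((a : ℂ) - 1))
      (fun u : ℝ => ((k * (1 - u) ^ (k - 1) * u ^ (a - 1) : ℝ) : ℂ)) (Set.Ioo 0 1) := by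
    intro u hu
    simp only [ofReal_mul, ofReal_cpow hu.1.le, ofReal_sub, ofReal_one]
  rw [integrableOn_Icc_iff_integrableOn_Ioo] at hi
  refine ⟨by simpa [IntegrableOn] using (hi.congr_fun heq measurableSet_Ioo).re, ?_⟩
  rw [integral_Icc_eq_integral_Ioo, setIntegral_congr_fun measurableSet_Ioo heq,
    integral_complex_ofReal] at he
  apply ofReal_injective
  rw [he]
  push_cast [← Complex.Gamma_ofReal]
  rfl

theorem lintegral_cesaro_weight_mul_rpow {k : ℝ} (hk : 0 < k) {a : ℝ} (ha : 0 < a) :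
    ∫⁻ u in Set.Ioo (0 : ℝ) 1, ENNReal.ofReal |k * (1 - u) ^ (k - 1)| *
        ENNReal.ofReal (u ^ (a - 1)) =
      ENNReal.ofReal (Real.Gamma (k + 1) * Real.Gamma a / Real.Gamma (k + a)) := by
  obtain ⟨hi, he⟩ := integral_cesaro_weight_mul_rpow hk ha
  have hnn (u : ℝ) (hu : u ∈ Set.Ioo (0 : ℝ) 1) : 0 ≤ k * (1 - u) ^ (k - 1) :=
    mul_nonneg hk.le (Real.rpow_nonneg (by linarith [hu.2]) _)
  rw [← he, ofReal_integral_eq_lintegral_ofReal hi]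
  · refine setLIntegral_congr_fun measurableSet_Ioo fun u hu => ?_
    rw [abs_of_nonneg (hnn u hu), ENNReal.ofReal_mul (hnn u hu)]
  · filter_upwards [ae_restrict_mem measurableSet_Ioo] with u hu
    exact mul_nonneg (hnn u hu) (Real.rpow_nonneg hu.1.le _)

theorem norm_Lp_two_le_of_lintegral_le {α : Type*} [MeasurableSpace α] {μ : Measure α}
    {f g : Lp ℂ 2 μ} {C : ℝ} (hC : 0 ≤ C)
    (h : ∫⁻ x, ‖f x‖ₑ ^ 2 ∂μ ≤ ENNReal.ofReal C ^ 2 * ∫⁻ x, ‖g x‖ₑ ^ 2 ∂μ) :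
    ‖f‖ ≤ C * ‖g‖ := by
  have hsq (f : α → ℂ) : eLpNorm f 2 μ ^ 2 = ∫⁻ x, ‖f x‖ₑ ^ 2 ∂μ := by
    simpa using eLpNorm_nnreal_pow_eq_lintegral (μ := μ) (f := f) (p := 2) two_ne_zero
  rw [← hsq, ← hsq, ← mul_pow, ENNReal.pow_le_pow_left_iff two_ne_zero] at h
  rw [Lp.norm_def, Lp.norm_def, ← ENNReal.toReal_ofReal hC, ← ENNReal.toReal_mul]
  exact ENNReal.toReal_mono (ENNReal.mul_ne_top ENNReal.ofReal_ne_top (Lp.eLpNorm_ne_top g)) h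

theorem norm_cesaro_le {k : ℝ} (hk : 0 < k) {f F : Lp ℂ 2 (volume : Measure ℝ)}
    (hF : ∀ᵐ x : ℝ ∂volume,
      F x = ∫ u in Set.Icc (0 : ℝ) 1, ((k * (1 - u) ^ (k - 1) : ℝ) : ℂ) * f (u * x)) :
    ‖F‖ ≤ Real.Gamma (k + 1) * Real.Gamma (1 / 2) / Real.Gamma (k + 1 / 2) * ‖f‖ := by
  have hC := lintegral_cesaro_weight_mul_rpow hk (a := 1 / 2) (by norm_num)
  rw [show (1 / 2 - 1 : ℝ) = -(1 / 2) by norm_num] at hC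
  have hC0 : 0 ≤ Real.Gamma (k + 1) * Real.Gamma (1 / 2) / Real.Gamma (k + 1 / 2) := by
    positivity
  refine norm_Lp_two_le_of_lintegral_le hC0 ?_
  rw [← hC]
  refine le_trans ?_ (lintegral_sq_lintegral_dilation_le measurableSet_Ioo
    (fun u hu => hu.1) (by fun_prop) (Lp.stronglyMeasurable f).measurable.enorm
    (by rw [hC]; exact ENNReal.ofReal_ne_top))
  refine lintegral_mono_ae ?_
  filter_upwards [hF] with x hx
  rw [hx, integral_Icc_eq_integral_Ioo]
  gcongr
  refine (enorm_integral_le_lintegral_enorm _).trans_eq (lintegral_congr fun u => ?_)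
  rw [enorm_mul, ← ofReal_norm, Complex.norm_real, Real.norm_eq_abs]

theorem memLp_two_indicator_rpow {a : ℝ} (ha : 1 / 2 < a) :
    MemLp ((Set.Ioo (0 : ℝ) 1).indicator fun x : ℝ => ((x ^ (a - 1) : ℝ) : ℂ)) 2 := by
  rw [memLp_indicator_iff_restrict measurableSet_Ioo, memLp_two_iff_integrable_sq_norm
    (Measurable.aestronglyMeasurable (by fun_prop))]
  have h : IntegrableOn (fun x : ℝ => x ^ (2 * a - 2)) (Set.Ioo 0 1) :=
    (intervalIntegrable_iff_integrableOn_Ioo_of_le zero_le_one).1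
      (intervalIntegral.intervalIntegrable_rpow' (by linarith))
  refine h.congr_fun (fun x hx => ?_) measurableSet_Ioo
  simp only
  rw [Complex.norm_real, Real.norm_of_nonneg (Real.rpow_nonneg hx.1.le _),
    ← Real.rpow_mul_natCast hx.1.le]
  congr 1
  push_cast
  ring

theorem le_opNorm_cesaro {k : ℝ} (hk : 0 < k)
    {T : Lp ℂ 2 (volume : Measure ℝ) →L[ℂ] Lp ℂ 2 (volume : Measure ℝ)}
    (hT : ∀ f : Lp ℂ 2 (volume : Measure ℝ),
      ∀ᵐ x : ℝ ∂volume,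
        T f x = ∫ u in Set.Icc (0 : ℝ) 1, ((k * (1 - u) ^ (k - 1) : ℝ) : ℂ) * f (u * x))
    {a : ℝ} (ha : 1 / 2 < a) :
    Real.Gamma (k + 1) * Real.Gamma a / Real.Gamma (k + a) ≤ ‖T‖ := by
  obtain ⟨-, he⟩ := integral_cesaro_weight_mul_rpow hk (a := a) (by linarith)
  set c := Real.Gamma (k + 1) * Real.Gamma a / Real.Gamma (k + a) with hc
  have hc0 : 0 ≤ c := by
    have : 0 < a := by linarith
    positivity
  set f : Lp ℂ 2 (volume : Measure ℝ) := (memLp_two_indicator_rpow ha).toLp _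
  have hf := (memLp_two_indicator_rpow ha).coeFn_toLp
  have hf0 : f ≠ 0 := by
    intro h0
    have h1 := Lp.eq_zero_iff_ae_eq_zero.1 h0
    have h2 : ∀ᵐ x : ℝ, x ∉ Set.Ioo (0 : ℝ) 1 := by
      filter_upwards [hf, h1] with x hx hx' hmem
      rw [hx', Set.indicator_of_mem hmem, Pi.zero_apply] at hx
      exact (Real.rpow_pos_of_pos hmem.1 (a - 1)).ne (by exact_mod_cast hx)
    simpa using measure_eq_zero_iff_ae_notMem.2 h2
  have hTf : c * ‖f‖ ≤ ‖T f‖ := by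
    have hnorm : ‖(c : ℂ) • f‖ = c * ‖f‖ := by
      rw [norm_smul, Complex.norm_real, Real.norm_of_nonneg hc0]
    rw [← hnorm]
    refine Lp.norm_le_norm_of_ae_le ?_
    filter_upwards [hT f, hf, Lp.coeFn_smul (c : ℂ) f] with x hTx hfx hsx
    rw [hsx, Pi.smul_apply, hfx]
    by_cases hx : x ∈ Set.Ioo (0 : ℝ) 1
    · have hq : Measure.QuasiMeasurePreserving (fun u : ℝ => u * x) volume volume := by
        refine ⟨by fun_prop, ?_⟩
        rw [Real.map_volume_mul_right hx.1.ne']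
        exact Measure.smul_absolutelyContinuous
      have hval : T f x = (c : ℂ) * ((x ^ (a - 1) : ℝ) : ℂ) := by
        rw [hTx, integral_Icc_eq_integral_Ioo, ← he, ← integral_complex_ofReal,
          ← integral_mul_const]
        refine setIntegral_congr_ae measurableSet_Ioo ?_
        filter_upwards [hq.ae hf] with u hu hmem
        have hux : u * x ∈ Set.Ioo (0 : ℝ) 1 :=
          ⟨mul_pos hmem.1 hx.1, by nlinarith [hmem.1, hmem.2, hx.1, hx.2]⟩
        rw [hu, Set.indicator_of_mem hux, Real.mul_rpow hmem.1.le hx.1.le]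
        push_cast
        ring
      rw [hval, Set.indicator_of_mem hx, smul_eq_mul]
    · simp [Set.indicator_of_notMem hx]
  exact le_of_mul_le_mul_right (hTf.trans (T.le_opNorm f)) (norm_pos_iff.2 hf0)

/-- The `(C,k)` Cesàro mean on `L²(ℝ)`: its symbol is
`φ(s) = Γ(k+1)Γ(1/2 - is)/Γ(k + 1/2 - is)` and its norm is `√π Γ(k+1)/Γ(k+1/2)`. -/
theorem cesaro_Ck_mean_symbol_and_norm (k : ℝ) (hk : 0 < k)
    (T : Lp ℂ 2 (volume : Measure ℝ) →L[ℂ] Lp ℂ 2 (volume : Measure ℝ))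
    (hT : ∀ f : Lp ℂ 2 (volume : Measure ℝ),
      ∀ᵐ x : ℝ ∂volume,
        T f x = ∫ u in Set.Icc (0 : ℝ) 1, ((k * (1 - u) ^ (k - 1) : ℝ) : ℂ) * f (u * x)) :
    (∀ s : ℝ,
      (∫ u in Set.Icc (0 : ℝ) 1,
          ((k * (1 - u) ^ (k - 1) : ℝ) : ℂ) * (u : ℂ) ^ (-(1 / 2 : ℂ) - Complex.I * (s : ℂ))) =
        Complex.Gamma (k + 1) * Complex.Gamma (1 / 2 - Complex.I * s) /
          Complex.Gamma (k + 1 / 2 - Complex.I * s)) ∧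
    ‖T‖ = Real.sqrt Real.pi * Real.Gamma (k + 1) / Real.Gamma (k + 1 / 2) := by
  constructor
  · intro s
    have h := (integrableOn_cesaro_symbol hk (a := 1 / 2 - Complex.I * s) (by simp)).2
    rw [show (1 / 2 - Complex.I * (s : ℂ) - 1) = -(1 / 2 : ℂ) - Complex.I * s by ring,
      ← add_sub_assoc] at h
    exact h
  · rw [mul_comm (Real.sqrt _), ← Real.Gamma_one_half_eq]
    refine le_antisymm (T.opNorm_le_bound (by positivity) fun f => norm_cesaro_le hk (hT f)) ?_
    have hcont : ContinuousAt
        (fun a : ℝ => Real.Gamma (k + 1) * Real.Gamma a / Real.Gamma (k + a)) (1 / 2) := by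
      have hΓ {b : ℝ} (hb : 0 < b) : ContinuousAt Real.Gamma b :=
        (Real.differentiableAt_Gamma fun m => by
          have : (0 : ℝ) ≤ m := m.cast_nonneg
          linarith).continuousAt
      refine (continuousAt_const.mul (hΓ (by norm_num))).div
        (ContinuousAt.comp (g := Real.Gamma) (hΓ (by positivity)) (by fun_prop)) ?_
      exact (Real.Gamma_pos_of_pos (by positivity)).ne'
    refine le_of_tendsto (hcont.tendsto.mono_left (nhdsWithin_le_nhds (s := Set.Ioi (1 / 2)))) ?_
    filter_upwards [self_mem_nhdsWithin] with a ha
    exact le_opNorm_cesaro hk hT ha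
end

section
/- Let A ≠ I be a real symmetric positive definite n×n matrix, Φ : ℕ → ℂ with ∑_{k=0}^∞ |Φ(k)| (det A)^{−k/2} < ∞, and let T be a continuous linear operator on L²(ℝⁿ; ℂ) such that for every f ∈ L², (Tf)(x) = ∑_{k=0}^∞ Φ(k) f(A^k x) for a.e. x. Define F(z) = ∑_{k=0}^∞ Φ(k) (det A)^{−k/2} z^k for |z| ≤ 1. Then the spectrum of T equals the image F(𝕋) of the unit circle 𝕋 = {z ∈ ℂ : |z| = 1} under F; in particular ‖T‖ = sup_{|z|=1} |F(z)|, and T is invertible if and only if inf_{|z|=1} |F(z)| > 0. -/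
open MeasureTheory Complex Filter Matrix
open scoped ENNReal ComplexConjugate

section LpSeries
variable {X E : Type*} [MeasurableSpace X] {μ : Measure X} [NormedAddCommGroup E] {p : ℝ≥0∞}

theorem Lp_coeFn_sum_range (g : ℕ → Lp E p μ) :
    ∀ᵐ x ∂μ, ∀ N : ℕ, (∑ k ∈ Finset.range N, g k : Lp E p μ) x =
      ∑ k ∈ Finset.range N, g k x := by
  rw [ae_all_iff]
  intro N
  induction N with
  | zero => simp only [Finset.range_zero, Finset.sum_empty]; exact Lp.coeFn_zero E p μ
  | succ N ih =>
    simp only [Finset.sum_range_succ]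
    filter_upwards [ih, Lp.coeFn_add (∑ k ∈ Finset.range N, g k) (g N)] with x h1 h2
    rw [h2, Pi.add_apply, h1]

variable [Fact (1 ≤ p)]

/-- A convergent series in `Lp` converges almost everywhere along a subsequence of its partial
sums. -/
theorem exists_subseq_ae_tendsto_of_hasSum {g : ℕ → Lp E p μ} {s : Lp E p μ} (hg : HasSum g s) :
    ∃ ns : ℕ → ℕ, StrictMono ns ∧ ∀ᵐ x ∂μ,
      Tendsto (fun i => ∑ k ∈ Finset.range (ns i), g k x) atTop (nhds (s x)) := by
  obtain ⟨ns, hns, h⟩ :=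
    (tendstoInMeasure_of_tendsto_Lp hg.tendsto_sum_nat).exists_seq_tendsto_ae
  refine ⟨ns, hns, ?_⟩
  filter_upwards [h, Lp_coeFn_sum_range g] with x hx hsum
  simpa only [hsum] using hx

theorem ae_summable_norm_of_summable_norm {g : ℕ → Lp E p μ} (hg : Summable fun k => ‖g k‖) :
    ∀ᵐ x ∂μ, Summable fun k => ‖g k x‖ := by
  let a : ℕ → Lp ℝ p μ := fun k => (Lp.memLp (g k)).norm.toLp _
  have ha : Summable a := by
    refine Summable.of_norm (hg.congr fun k => ?_)
    rw [Lp.norm_toLp, eLpNorm_norm, Lp.norm_def]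
  obtain ⟨ns, hns, h⟩ := exists_subseq_ae_tendsto_of_hasSum ha.hasSum
  have hcoe : ∀ᵐ x ∂μ, ∀ k, a k x = ‖g k x‖ :=
    ae_all_iff.2 fun k => MemLp.coeFn_toLp (Lp.memLp (g k)).norm
  filter_upwards [h, hcoe] with x hx hax
  simp only [hax] at hx
  obtain ⟨C, hC⟩ := hx.bddAbove_range
  refine summable_of_sum_range_le (c := C) (fun _ => norm_nonneg _) fun N => ?_
  exact (Finset.sum_le_sum_of_subset_of_nonneg
    (Finset.range_subset_range.2 (hns.id_le N)) fun _ _ _ => norm_nonneg _).trans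
    (hC ⟨N, rfl⟩)

/-- A norm-convergent series in `Lp` converges almost everywhere to its sum. -/
theorem ae_hasSum_of_summable_norm [CompleteSpace E] {g : ℕ → Lp E p μ}
    (hg : Summable fun k => ‖g k‖) :
    ∀ᵐ x ∂μ, HasSum (fun k => g k x) ((∑' k, g k : Lp E p μ) x) := by
  obtain ⟨ns, hns, h⟩ := exists_subseq_ae_tendsto_of_hasSum hg.of_norm.hasSum
  filter_upwards [h, ae_summable_norm_of_summable_norm hg] with x hx hs
  have hsum := hs.of_norm.hasSum
  rwa [tendsto_nhds_unique hx (hsum.tendsto_sum_nat.comp hns.tendsto_atTop)]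

end LpSeries

section WeightedComposition
variable {X : Type*} [MeasurableSpace X] {μ : Measure X}

theorem memLp_weightedComp {w : X → ℂ} {φ : X → X} (hw : AEStronglyMeasurable w μ)
    (hφ : Measure.QuasiMeasurePreserving φ μ μ)
    (h : ∀ f : X → ℂ, AEStronglyMeasurable f μ →
      eLpNorm (fun x => w x * f (φ x)) 2 μ = eLpNorm f 2 μ) (f : Lp ℂ 2 μ) :
    MemLp (fun x => w x * f (φ x)) 2 μ :=
  ⟨hw.mul ((Lp.aestronglyMeasurable f).comp_quasiMeasurePreserving hφ), by
    rw [h f (Lp.aestronglyMeasurable f)]; exact Lp.eLpNorm_lt_top f⟩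

/-- The isometry `f ↦ w · (f ∘ φ)` of `L²`. -/
noncomputable def weightedComp (w : X → ℂ) (φ : X → X) (hw : AEStronglyMeasurable w μ)
    (hφ : Measure.QuasiMeasurePreserving φ μ μ)
    (h : ∀ f : X → ℂ, AEStronglyMeasurable f μ →
      eLpNorm (fun x => w x * f (φ x)) 2 μ = eLpNorm f 2 μ) :
    Lp ℂ 2 μ →ₗᵢ[ℂ] Lp ℂ 2 μ where
  toFun f := (memLp_weightedComp hw hφ h f).toLp _
  map_add' f g := by
    rw [← MemLp.toLp_add]
    refine MemLp.toLp_congr _ _ ?_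
    filter_upwards [hφ.ae (Lp.coeFn_add f g)] with x hx
    rw [hx, Pi.add_apply, mul_add, Pi.add_apply]
  map_smul' c f := by
    rw [RingHom.id_apply, ← MemLp.toLp_const_smul]
    refine MemLp.toLp_congr _ _ ?_
    filter_upwards [hφ.ae (Lp.coeFn_smul c f)] with x hx
    rw [hx, Pi.smul_apply, Pi.smul_apply, mul_smul_comm]
  norm_map' f := by
    change ‖(memLp_weightedComp hw hφ h f).toLp _‖ = ‖f‖
    rw [Lp.norm_toLp, h f (Lp.aestronglyMeasurable f), Lp.norm_def]

theorem coeFn_weightedComp {w : X → ℂ} {φ : X → X} (hw : AEStronglyMeasurable w μ)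
    (hφ : Measure.QuasiMeasurePreserving φ μ μ)
    (h : ∀ f : X → ℂ, AEStronglyMeasurable f μ →
      eLpNorm (fun x => w x * f (φ x)) 2 μ = eLpNorm f 2 μ) (f : Lp ℂ 2 μ) :
    ∀ᵐ x ∂μ, weightedComp w φ hw hφ h f x = w x * f (φ x) :=
  MemLp.coeFn_toLp (memLp_weightedComp hw hφ h f)

/-- Multiplication by a unimodular function is an invertible operator on `L²`. -/
theorem exists_mul_units {m : X → ℂ} (hm : Measurable m) (h1 : ∀ x, ‖m x‖ = 1) :
    ∃ M : (Lp ℂ 2 μ →L[ℂ] Lp ℂ 2 μ)ˣ, ∀ f : Lp ℂ 2 μ,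
      ∀ᵐ x ∂μ, (M : Lp ℂ 2 μ →L[ℂ] Lp ℂ 2 μ) f x = m x * f x := by
  have key : ∀ m : X → ℂ, Measurable m → (∀ x, ‖m x‖ = 1) →
      ∃ M : Lp ℂ 2 μ →L[ℂ] Lp ℂ 2 μ, ∀ f : Lp ℂ 2 μ, ∀ᵐ x ∂μ, M f x = m x * f x := by
    intro m hm h1
    have h : ∀ f : X → ℂ, AEStronglyMeasurable f μ →
        eLpNorm (fun x => m x * f (id x)) 2 μ = eLpNorm f 2 μ := fun f _ =>
      eLpNorm_congr_norm_ae (.of_forall fun x => by simp [h1])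
    exact ⟨(weightedComp m id hm.aestronglyMeasurable (.id μ) h).toContinuousLinearMap,
      coeFn_weightedComp hm.aestronglyMeasurable (.id μ) h⟩
  obtain ⟨M, hM⟩ := key m hm h1
  obtain ⟨N, hN⟩ := key (fun x => conj (m x)) (by fun_prop) (by simpa using h1)
  have hmul : ∀ x, m x * conj (m x) = 1 := fun x => by
    rw [Complex.mul_conj, Complex.normSq_eq_norm_sq, h1]; simp
  refine ⟨⟨M, N, ?_, ?_⟩, hM⟩
  · ext1 f
    refine Lp.ext ?_
    filter_upwards [hM (N f), hN f] with x h2 h3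
    change M (N f) x = f x
    rw [h2, h3, ← mul_assoc, hmul, one_mul]
  · ext1 f
    refine Lp.ext ?_
    filter_upwards [hN (M f), hM f] with x h2 h3
    change N (M f) x = f x
    rw [h2, h3, ← mul_assoc, mul_comm (conj _), hmul, one_mul]

end WeightedComposition

section Unitary
variable {B : Type*} [CStarAlgebra B]

/-- A unitary that is similar to each of its rotations has the full circle as spectrum. -/
theorem spectrum_eq_sphere_of_rotation [Nontrivial B] {u : B} (hu : u ∈ unitary B)
    (h : ∀ c : ℂ, ‖c‖ = 1 → ∃ M : Bˣ, (M : B) * u * ((M⁻¹ : Bˣ) : B) = c • u) :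
    spectrum ℂ u = Metric.sphere 0 1 := by
  have hsub := spectrum.subset_circle_of_unitary (𝕜 := ℂ) hu
  refine hsub.antisymm fun z hz => ?_
  obtain ⟨z₀, hz₀⟩ := spectrum.nonempty u
  have hn₀ : ‖z₀‖ = 1 := by simpa using hsub hz₀
  have hn : ‖z‖ = 1 := by simpa using hz
  have hz₀0 : z₀ ≠ 0 := norm_ne_zero_iff.1 (by simp [hn₀])
  have hz0 : z ≠ 0 := norm_ne_zero_iff.1 (by simp [hn])
  obtain ⟨M, hM⟩ := h (z / z₀) (by simp [hn, hn₀])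
  rw [← spectrum.units_conjugate (u := M), hM]
  have := (spectrum.smul_mem_smul_iff (r := Units.mk0 (z / z₀) (div_ne_zero hz0 hz₀0))).2 hz₀
  simpa [Units.smul_def, hz₀0] using this

theorem continuousOn_tsum_mul_pow {c : ℕ → ℂ} (hc : Summable fun k => ‖c k‖) :
    ContinuousOn (fun z : ℂ => ∑' k, c k * z ^ k) (Metric.sphere 0 1) := by
  refine continuousOn_tsum (fun k => by fun_prop) hc fun k z hz => ?_
  have : ‖z‖ = 1 := by simpa using hz
  simp [this]

theorem cfc_tsum_mul_pow {u : B} (hu : u ∈ unitary B) {c : ℕ → ℂ}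
    (hc : Summable fun k => ‖c k‖) :
    cfc (fun z : ℂ => ∑' k, c k * z ^ k) u = ∑' k, c k • u ^ k := by
  have hsub := spectrum.subset_circle_of_unitary (𝕜 := ℂ) hu
  have hnorm : ∀ z ∈ spectrum ℂ u, ‖z‖ = 1 := fun z hz => by simpa using hsub hz
  have hnormal : IsStarNormal u := isStarNormal_of_mem_unitary hu
  let X : C(spectrum ℂ u, ℂ) := (ContinuousMap.id ℂ).restrict (spectrum ℂ u)
  have hsum : Summable fun k => c k • X ^ k := by
    refine Summable.of_norm_bounded hc fun k => ?_
    refine (ContinuousMap.norm_le _ (norm_nonneg _)).2 fun z => ?_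
    simp [X, hnorm z z.2]
  have hcont := (continuousOn_tsum_mul_pow hc).mono hsub
  rw [cfc_apply _ u hnormal hcont]
  have key : (⟨(spectrum ℂ u).domRestrict (fun z : ℂ => ∑' k, c k * z ^ k), hcont.domRestrict⟩ :
      C(spectrum ℂ u, ℂ)) = ∑' k, c k • X ^ k := by
    ext z
    rw [← ContinuousMap.tsum_apply hsum]
    simp [X, Set.domRestrict]
  have hmap := hsum.map_tsum (cfcHom (R := ℂ) hnormal) (cfcHom_continuous hnormal)
  refine (congrArg _ key).trans (hmap.trans (tsum_congr fun k => ?_))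
  rw [map_smul, map_pow, cfcHom_id hnormal]

end Unitary

section Dilation
variable {n : ℕ}

theorem quasiMeasurePreserving_mulVec {A : Matrix (Fin n) (Fin n) ℝ} (hA : 0 < A.det) :
    Measure.QuasiMeasurePreserving (fun x : Fin n → ℝ => A *ᵥ x) volume volume := by
  refine ⟨by fun_prop, ?_⟩
  have := Real.map_matrix_volume_pi_eq_smul_volume_pi hA.ne'
  change Measure.map (Matrix.toLin' A) volume ≪ volume
  rw [this]
  exact Measure.smul_absolutelyContinuous

theorem eLpNorm_dilation {A : Matrix (Fin n) (Fin n) ℝ} (hA : 0 < A.det)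
    {f : (Fin n → ℝ) → ℂ} (hf : AEStronglyMeasurable f volume) :
    eLpNorm (fun x => ((√A.det : ℝ) : ℂ) * f (A *ᵥ x)) 2 volume = eLpNorm f 2 volume := by
  have hq := quasiMeasurePreserving_mulVec hA
  have hmap : Measure.map (fun x : Fin n → ℝ => A *ᵥ x) volume =
      ENNReal.ofReal |A.det⁻¹| • volume := Real.map_matrix_volume_pi_eq_smul_volume_pi hA.ne'
  have h1 := eLpNorm_map_measure (p := 2) (hf.mono_ac hq.absolutelyContinuous)
    hq.measurable.aemeasurable
  rw [hmap, eLpNorm_smul_measure_of_ne_top (by simp)] at h1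
  have h2 := eLpNorm_const_smul ((√A.det : ℝ) : ℂ) (fun x => f (A *ᵥ x)) 2
    (volume : Measure (Fin n → ℝ))
  change eLpNorm (fun x => ((√A.det : ℝ) : ℂ) * f (A *ᵥ x)) 2 volume = _ at h2
  change _ = eLpNorm (fun x => f (A *ᵥ x)) 2 volume at h1
  rw [h2, ← h1, smul_eq_mul, ← mul_assoc]
  have hs : 0 < √A.det := Real.sqrt_pos.2 hA
  have : ‖((√A.det : ℝ) : ℂ)‖ₑ * ENNReal.ofReal |A.det⁻¹| ^ (1 / (2 : ℝ≥0∞)).toReal = 1 := by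
    rw [ENNReal.ofReal_rpow_of_nonneg (abs_nonneg _) (by simp), ← ofReal_norm,
      ← ENNReal.ofReal_mul (norm_nonneg _), abs_of_pos (inv_pos.2 hA), Complex.norm_real,
      Real.norm_of_nonneg hs.le]
    have : (1 / (2 : ℝ≥0∞)).toReal = 1 / 2 := by simp
    rw [this, ← Real.sqrt_eq_rpow, Real.sqrt_inv, mul_inv_cancel₀ hs.ne', ENNReal.ofReal_one]
  rw [this, one_mul]

theorem exists_dilation_isometry {A : Matrix (Fin n) (Fin n) ℝ} (hA : 0 < A.det) :
    ∃ U : Lp ℂ 2 (volume : Measure (Fin n → ℝ)) →ₗᵢ[ℂ] Lp ℂ 2 (volume : Measure (Fin n → ℝ)),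
      ∀ f, ∀ᵐ x, U f x = ((√A.det : ℝ) : ℂ) * f (A *ᵥ x) :=
  ⟨weightedComp (fun _ => ((√A.det : ℝ) : ℂ)) _ aestronglyMeasurable_const
      (quasiMeasurePreserving_mulVec hA) fun _ hf => eLpNorm_dilation hA hf,
    coeFn_weightedComp _ _ _⟩

/-- The normalized dilation `f ↦ (det A)^{1/2} f(A ·)` is unitary on `L²(ℝⁿ)`. -/
theorem exists_dilation_unitary {A : Matrix (Fin n) (Fin n) ℝ} (hA : 0 < A.det) :
    ∃ U ∈ unitary (Lp ℂ 2 (volume : Measure (Fin n → ℝ)) →L[ℂ]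
        Lp ℂ 2 (volume : Measure (Fin n → ℝ))),
      ∀ f, ∀ᵐ x, U f x = ((√A.det : ℝ) : ℂ) * f (A *ᵥ x) := by
  have hA' : 0 < A⁻¹.det := by rw [Matrix.det_nonsing_inv, Ring.inverse_eq_inv']; positivity
  obtain ⟨U, hU⟩ := exists_dilation_isometry hA
  obtain ⟨V, hV⟩ := exists_dilation_isometry hA'
  have hsurj : Function.Surjective U := fun f => by
    refine ⟨V f, Lp.ext ?_⟩
    filter_upwards [hU (V f), (quasiMeasurePreserving_mulVec hA).ae (hV f)] with x h1 h2
    rw [h1, h2, Matrix.mulVec_mulVec, Matrix.nonsing_inv_mul _ hA.ne'.isUnit, Matrix.one_mulVec,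
      ← mul_assoc, ← Complex.ofReal_mul, ← Real.sqrt_mul hA.le, Matrix.det_nonsing_inv,
      Ring.inverse_eq_inv', mul_inv_cancel₀ hA.ne', Real.sqrt_one, Complex.ofReal_one, one_mul]
  exact ⟨_, (Unitary.linearIsometryEquiv.symm (LinearIsometryEquiv.ofSurjective U hsurj)).2, hU⟩

theorem dilation_pow_apply {A : Matrix (Fin n) (Fin n) ℝ} (hA : 0 < A.det)
    {U : Lp ℂ 2 (volume : Measure (Fin n → ℝ)) →L[ℂ] Lp ℂ 2 (volume : Measure (Fin n → ℝ))}
    (hU : ∀ f, ∀ᵐ x, U f x = ((√A.det : ℝ) : ℂ) * f (A *ᵥ x))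
    (f : Lp ℂ 2 (volume : Measure (Fin n → ℝ))) (k : ℕ) :
    ∀ᵐ x, (U ^ k) f x = ((√A.det : ℝ) : ℂ) ^ k * f ((A ^ k) *ᵥ x) := by
  induction k with
  | zero => simp
  | succ k ih =>
    filter_upwards [hU ((U ^ k) f), (quasiMeasurePreserving_mulVec hA).ae ih] with x h1 h2
    rw [pow_succ' U, mul_apply_eq_comp, h1, h2, Matrix.mulVec_mulVec, ← pow_succ,
      pow_succ' ((√A.det : ℝ) : ℂ), mul_assoc]

theorem exists_eigenvector_ne_one {A : Matrix (Fin n) (Fin n) ℝ} (hA : A.PosDef) (hA1 : A ≠ 1) :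
    ∃ (v : Fin n → ℝ) (l : ℝ), v ≠ 0 ∧ 0 < l ∧ l ≠ 1 ∧ A *ᵥ v = l • v := by
  obtain ⟨j, hj⟩ : ∃ j, hA.isHermitian.eigenvalues j ≠ 1 := by
    by_contra! h
    refine hA1 ?_
    rw [hA.isHermitian.spectral_theorem]
    have : (RCLike.ofReal ∘ hA.isHermitian.eigenvalues : Fin n → ℝ) = fun _ => 1 := by
      ext j; simp [h]
    rw [this, Matrix.diagonal_one, map_one]
  refine ⟨(hA.isHermitian.eigenvectorBasis j).ofLp, _, fun h0 => ?_, hA.eigenvalues_pos j, hj,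
    hA.isHermitian.mulVec_eigenvectorBasis j⟩
  exact hA.isHermitian.eigenvectorBasis.toBasis.ne_zero j (by simpa using h0)

theorem ae_dotProduct_ne_zero {v : Fin n → ℝ} (hv : v ≠ 0) :
    ∀ᵐ x : Fin n → ℝ, v ⬝ᵥ x ≠ 0 := by
  have h : LinearMap.ker (dotProductBilin ℝ ℝ v) ≠ ⊤ := fun h => by
    have : v ∈ LinearMap.ker (dotProductBilin ℝ ℝ v) := h ▸ Submodule.mem_top
    exact hv (dotProduct_self_eq_zero.1 this)
  have := Measure.addHaar_submodule (volume : Measure (Fin n → ℝ)) _ h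
  rw [ae_iff]
  simp only [not_not]
  exact this

/-- A unimodular function on which composition with `A` acts as a given rotation. -/
theorem exists_unimodular_rotation {A : Matrix (Fin n) (Fin n) ℝ} (hA : A.PosDef) (hA1 : A ≠ 1)
    {c : ℂ} (hc : ‖c‖ = 1) :
    ∃ m : (Fin n → ℝ) → ℂ, Measurable m ∧ (∀ x, ‖m x‖ = 1) ∧ ∀ᵐ x, m (A *ᵥ x) = c * m x := by
  obtain ⟨v, l, hv, hl, hl1, hAv⟩ := exists_eigenvector_ne_one hA hA1
  have hsym : Aᵀ = A := by simpa using hA.isHermitian.eq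
  have hdot : ∀ x, v ⬝ᵥ (A *ᵥ x) = l * (v ⬝ᵥ x) := fun x => by
    rw [Matrix.dotProduct_mulVec, ← Matrix.mulVec_transpose, hsym, hAv, smul_dotProduct,
      smul_eq_mul]
  refine ⟨fun x => Complex.exp (((Complex.arg c * (Real.log (v ⬝ᵥ x) / Real.log l) : ℝ) : ℂ) * I),
    ?_, fun x => Complex.norm_exp_ofReal_mul_I _, ?_⟩
  · have : Measurable fun x : Fin n → ℝ => v ⬝ᵥ x :=
      Continuous.measurable (by unfold dotProduct; fun_prop)
    fun_prop
  · filter_upwards [ae_dotProduct_ne_zero hv] with x hx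
    have hlog : Real.log l ≠ 0 := Real.log_ne_zero_of_pos_of_ne_one hl hl1
    rw [hdot, Real.log_mul hl.ne' hx, add_div, div_self hlog, mul_add, mul_one,
      Complex.ofReal_add, add_mul, Complex.exp_add]
    congr 1
    simpa [hc] using Complex.norm_mul_exp_arg_mul_I c

/-- The spectrum of the normalized dilation by a positive definite `A ≠ 1` is the unit circle. -/
theorem spectrum_dilation {A : Matrix (Fin n) (Fin n) ℝ} (hA : A.PosDef) (hA1 : A ≠ 1)
    {U : Lp ℂ 2 (volume : Measure (Fin n → ℝ)) →L[ℂ] Lp ℂ 2 (volume : Measure (Fin n → ℝ))}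
    (hUu : U ∈ unitary (Lp ℂ 2 (volume : Measure (Fin n → ℝ)) →L[ℂ]
      Lp ℂ 2 (volume : Measure (Fin n → ℝ))))
    (hU : ∀ f, ∀ᵐ x, U f x = ((√A.det : ℝ) : ℂ) * f (A *ᵥ x))
    [Nontrivial (Lp ℂ 2 (volume : Measure (Fin n → ℝ)))] :
    spectrum ℂ U = Metric.sphere 0 1 := by
  refine spectrum_eq_sphere_of_rotation hUu fun c hc => ?_
  obtain ⟨m, hm, hm1, hrot⟩ := exists_unimodular_rotation hA hA1 hc
  obtain ⟨M, hM⟩ := exists_mul_units (μ := (volume : Measure (Fin n → ℝ))) hm hm1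
  refine ⟨M⁻¹, ?_⟩
  rw [inv_inv, mul_assoc, Units.inv_mul_eq_iff_eq_mul]
  ext1 f
  refine Lp.ext ?_
  filter_upwards [hU (M.val f),
    (quasiMeasurePreserving_mulVec hA.det_pos).ae (hM f), hrot, hM (U f), hU f,
    Lp.coeFn_smul c (M.val (U f))]
    with x h1 h2 h3 h4 h5 h6
  rw [mul_smul_comm, _root_.smul_apply, mul_apply_eq_comp,
    mul_apply_eq_comp, h6, Pi.smul_apply, h1, h2, h3, h4, h5, smul_eq_mul]
  ring

theorem nontrivial_L2 : Nontrivial (Lp ℂ 2 (volume : Measure (Fin n → ℝ))) := by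
  have hfin : (volume (Metric.ball (0 : Fin n → ℝ) 1)) ≠ ∞ := measure_ball_lt_top.ne
  refine ⟨indicatorConstLp 2 Metric.isOpen_ball.measurableSet hfin (1 : ℂ), 0, ?_⟩
  rw [← norm_ne_zero_iff, norm_indicatorConstLp (by simp) (by simp)]
  have : 0 < volume.real (Metric.ball (0 : Fin n → ℝ) 1) :=
    ENNReal.toReal_pos (Metric.measure_ball_pos _ _ one_pos).ne' hfin
  rw [norm_one, one_mul]
  exact (Real.rpow_pos_of_pos this _).ne'

end Dilation

/-- Discrete Hausdorff operator `(Tf)(x) = ∑_k Φ(k) f(Aᵏx)` on `L²(ℝⁿ)` with `A` symmetric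
positive definite, `A ≠ I`: with `F(z) = ∑_k Φ(k) (det A)^{-k/2} zᵏ`, the spectrum of `T` is
the image `F(𝕋)` of the unit circle, `‖T‖ = sup_{|z|=1} |F(z)|`, and `T` is invertible iff
`inf_{|z|=1} |F(z)| > 0`. -/
theorem discrete_hausdorff_spectrum (n : ℕ) (A : Matrix (Fin n) (Fin n) ℝ)
    (hsym : A.IsSymm) (hpos : A.PosDef) (hA1 : A ≠ 1)
    (Φ : ℕ → ℂ)
    (hsum : Summable fun k : ℕ => ‖Φ k‖ * A.det ^ (-(k : ℝ) / 2))
    (T : Lp ℂ 2 (volume : Measure (Fin n → ℝ)) →L[ℂ] Lp ℂ 2 (volume : Measure (Fin n → ℝ)))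
    (hT : ∀ f : Lp ℂ 2 (volume : Measure (Fin n → ℝ)),
      ∀ᵐ x : Fin n → ℝ ∂volume, T f x = ∑' k : ℕ, Φ k * f ((A ^ k).mulVec x))
    (F : ℂ → ℂ)
    (hF : ∀ z : ℂ, F z = ∑' k : ℕ, Φ k * ((A.det ^ (-(k : ℝ) / 2) : ℝ) : ℂ) * z ^ k) :
    spectrum ℂ T = F '' {z : ℂ | ‖z‖ = 1} ∧
    ‖T‖ = ⨆ z : {z : ℂ // ‖z‖ = 1}, ‖F z‖ ∧
    (Function.Bijective T ↔ 0 < ⨅ z : {z : ℂ // ‖z‖ = 1}, ‖F z‖) := by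
  have hdet : 0 < A.det := hpos.det_pos
  have hs : 0 < √A.det := Real.sqrt_pos.2 hdet
  have := nontrivial_L2 (n := n)
  obtain ⟨U, hUu, hU⟩ := exists_dilation_unitary hdet
  have hspecU := spectrum_dilation hpos hA1 hUu hU
  have hnormal : IsStarNormal U := isStarNormal_of_mem_unitary hUu
  let c : ℕ → ℂ := fun k => Φ k * ((A.det ^ (-(k : ℝ) / 2) : ℝ) : ℂ)
  have hc : Summable fun k => ‖c k‖ := hsum.congr fun k => by
    rw [norm_mul, Complex.norm_real, Real.norm_of_nonneg (by positivity)]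
  have hcw : ∀ k, c k * ((√A.det : ℝ) : ℂ) ^ k = Φ k := fun k => by
    have : A.det ^ (-(k : ℝ) / 2) * √A.det ^ k = 1 := by
      rw [Real.sqrt_eq_rpow, ← Real.rpow_natCast, ← Real.rpow_mul hdet.le,
        ← Real.rpow_add hdet]
      ring_nf
      exact Real.rpow_zero _
    rw [mul_assoc, ← Complex.ofReal_pow, ← Complex.ofReal_mul, this, Complex.ofReal_one, mul_one]
  have hFc : F = fun z => ∑' k, c k * z ^ k := funext hF
  have hUnorm : ∀ k, ‖U ^ k‖ ≤ 1 := fun k =>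
    (CStarRing.norm_of_mem_unitary (pow_mem hUu k)).le
  have hsumU : Summable fun k => c k • U ^ k :=
    Summable.of_norm_bounded hc fun k => by
      rw [norm_smul]; exact mul_le_of_le_one_right (norm_nonneg _) (hUnorm k)
  have hTU : T = cfc F U := by
    rw [hFc, cfc_tsum_mul_pow hUu hc]
    ext1 f
    have happly : (∑' k, c k • U ^ k) f = ∑' k, c k • (U ^ k) f :=
      (ContinuousLinearMap.apply ℂ (Lp ℂ 2 (volume : Measure (Fin n → ℝ))) f).map_tsum hsumU
    rw [happly]
    have hsumf : Summable fun k => ‖c k • (U ^ k) f‖ :=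
      Summable.of_nonneg_of_le (fun _ => norm_nonneg _) (fun k => by
        rw [norm_smul]
        exact mul_le_mul_of_nonneg_left (((U ^ k).le_opNorm f).trans
          (mul_le_of_le_one_left (norm_nonneg _) (hUnorm k))) (norm_nonneg _))
        (hc.mul_right ‖f‖)
    refine Lp.ext ?_
    filter_upwards [hT f, ae_hasSum_of_summable_norm hsumf,
      ae_all_iff.2 fun k => Lp.coeFn_smul (c k) ((U ^ k) f),
      ae_all_iff.2 fun k => dilation_pow_apply hdet hU f k] with x h1 h2 h3 h4
    rw [h1, ← h2.tsum_eq]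
    refine tsum_congr fun k => ?_
    rw [h3, Pi.smul_apply, h4, smul_eq_mul, ← mul_assoc, hcw]
  have hcircle : {z : ℂ | ‖z‖ = 1} = Metric.sphere 0 1 := by ext; simp
  have hcont : ContinuousOn F (Metric.sphere 0 1) := hFc ▸ continuousOn_tsum_mul_pow hc
  have hcont' : ContinuousOn F (spectrum ℂ U) := hspecU ▸ hcont
  have hspec : spectrum ℂ T = F '' {z : ℂ | ‖z‖ = 1} := by
    rw [hTU, cfc_map_spectrum F U, hspecU, hcircle]
  refine ⟨hspec, ?_, ?_⟩
  · have hg := IsGreatest.norm_cfc F U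
    rw [← hTU, hspecU, ← hcircle] at hg
    rw [← hg.isLUB.csSup_eq hg.nonempty, sSup_image']
    rfl
  · rw [← ContinuousLinearMap.isUnit_iff_bijective, ← spectrum.zero_notMem_iff ℂ, hspec]
    have : Nonempty {z : ℂ // ‖z‖ = 1} := ⟨⟨1, norm_one⟩⟩
    have hbdd : BddBelow (Set.range fun z : {z : ℂ // ‖z‖ = 1} => ‖F z‖) :=
      ⟨0, by rintro _ ⟨z, rfl⟩; exact norm_nonneg _⟩
    constructor
    · intro h
      obtain ⟨z₀, hz₀, hmin⟩ := (isCompact_sphere (0 : ℂ) 1).exists_isMinOn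
        ⟨1, by simp⟩ hcont.norm
      refine lt_of_lt_of_le (norm_pos_iff.2 fun h0 => h ⟨z₀, by simpa using hz₀, h0⟩)
        (le_ciInf fun z => hmin (by simpa using z.2))
    · rintro h ⟨z, hz, h0⟩
      have := h.trans_le (ciInf_le hbdd ⟨z, hz⟩)
      simp [h0] at this
end
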